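/- arXiv:1309.4337 — 4 statements merged into one kernel-verified Lean document; each statement's English description precedes it below -/
import Mathlib

section
/- Let Ω ⊆ ℂ be a measurable set of finite two-dimensional Lebesgue measure |Ω|. Then for every z ∈ ℂ, ∬_Ω 1/|ζ − z| dA(ζ) ≤ 2√π · |Ω|^{1/2}, where dA denotes two-dimensional Lebesgue measure. -/
open MeasureTheory Real

theorem aux_tail (T : ℝ) (hT : 0 < T) :
    ∫⁻ t in Set.Ioi T, ENNReal.ofReal (π * t ^ (-2 : ℝ)) = ENNReal.ofReal (π / T) := by
  rw [← ofReal_integral_eq_lintegral_ofReal]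
  · rw [integral_const_mul, integral_Ioi_rpow_of_lt (by norm_num) hT]
    congr 1
    have : (-2 + 1 : ℝ) = -1 := by norm_num
    rw [this, rpow_neg_one]
    field_simp
  · exact (integrableOn_Ioi_rpow_of_lt (by norm_num) hT).const_mul π
  · filter_upwards [ae_restrict_mem measurableSet_Ioi] with t ht
    have : 0 < t := hT.trans ht
    simp only [Pi.zero_apply]
    positivity

/-- If `Ω ⊆ ℂ` is measurable with finite two-dimensional Lebesgue
measure, then for every `z ∈ ℂ` we have
`∬_Ω 1/|ζ − z| dA(ζ) ≤ 2 √π |Ω|^{1/2}` (in particular the integral is finite). -/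
theorem cauchy_kernel_integral_bound
    (Ω : Set ℂ) (hΩ : MeasurableSet Ω) (hfin : volume Ω < ⊤) (z : ℂ) :
    ∫⁻ ζ in Ω, ENNReal.ofReal (1 / ‖ζ - z‖) ∂volume
      ≤ ENNReal.ofReal (2 * Real.sqrt π * Real.sqrt ((volume Ω).toReal)) := by
  by_cases h0 : volume Ω = 0
  · rw [Measure.restrict_eq_zero.2 h0]
    simp
  have hV : 0 < (volume Ω).toReal := ENNReal.toReal_pos h0 hfin.ne
  set V := (volume Ω).toReal with hVdef
  have hVe : volume Ω = ENNReal.ofReal V := (ENNReal.ofReal_toReal hfin.ne).symm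
  rw [lintegral_eq_lintegral_meas_lt _ (Filter.Eventually.of_forall fun _ => by
    simp only [Pi.zero_apply]; positivity) (by fun_prop)]
  have hp := Real.pi_pos
  set T := √π / √V with hTdef
  have hT : 0 < T := by positivity
  rw [← Set.Ioc_union_Ioi_eq_Ioi hT.le]
  refine (lintegral_union_le _ _ _).trans ?_
  have h1 : ∫⁻ t in Set.Ioc 0 T, (volume.restrict Ω) {a : ℂ | t < 1 / ‖a - z‖}
      ≤ ENNReal.ofReal (V * T) := by
    calc _ ≤ ∫⁻ t in Set.Ioc 0 T, ENNReal.ofReal V := by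
          refine lintegral_mono fun t => ?_
          refine (measure_mono (Set.subset_univ _)).trans ?_
          rw [Measure.restrict_apply_univ, hVe]
      _ = _ := by
          rw [lintegral_const, Measure.restrict_apply_univ, Real.volume_Ioc, sub_zero,
            ENNReal.ofReal_mul hV.le]
  have h2 : ∫⁻ t in Set.Ioi T, (volume.restrict Ω) {a : ℂ | t < 1 / ‖a - z‖}
      ≤ ENNReal.ofReal (π / T) := by
    rw [← aux_tail T hT]
    refine setLIntegral_mono' measurableSet_Ioi fun t ht => ?_
    have ht0 : 0 < t := hT.trans ht
    refine (Measure.restrict_apply_le _ _).trans ?_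
    have hsub : {a : ℂ | t < 1 / ‖a - z‖} ⊆ Metric.ball z t⁻¹ := by
      intro a ha
      simp only [Set.mem_setOf_eq] at ha
      rw [Metric.mem_ball, dist_eq_norm]
      have h : 0 < ‖a - z‖ := by
        by_contra hn
        have : ‖a - z‖ = 0 := le_antisymm (not_lt.1 hn) (norm_nonneg _)
        rw [this] at ha
        simp at ha
        linarith
      rw [one_div] at ha
      exact (lt_inv_comm₀ ht0 h).1 ha
    refine (measure_mono hsub).trans ?_
    rw [Complex.volume_ball, mul_comm π, ENNReal.ofReal_mul (by positivity),
      ← ENNReal.ofReal_pow (by positivity)]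
    have e : (t⁻¹) ^ 2 = t ^ (-2 : ℝ) := by
      rw [rpow_neg ht0.le, inv_pow]
      norm_num
    rw [e, ← NNReal.coe_real_pi, ENNReal.ofReal_coe_nnreal]
  refine (add_le_add h1 h2).trans ?_
  rw [← ENNReal.ofReal_add (by positivity) (by positivity)]
  apply ENNReal.ofReal_le_ofReal
  apply le_of_eq
  have hs : 0 < √V := by positivity
  have hq : 0 < √π := by positivity
  have a1 : V * T = √π * √V := by
    rw [hTdef]; field_simp; rw [Real.sq_sqrt hV.le]
  have a2 : π / T = √π * √V := by
    rw [hTdef]; field_simp; rw [Real.sq_sqrt hp.le]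
  rw [a1, a2]; ring
end

section
/- Let Ω ⊆ ℂ be an open bounded set with 0 ∈ Ω, and suppose Ω satisfies the analytic Poincaré inequality: there is a constant C₀ > 0 such that for every holomorphic F on Ω with ∬_Ω |F′|² dA < ∞ one has ∬_Ω |F − F(0)|² dA ≤ C₀² ∬_Ω |F′|² dA. Then there exist constants C, C′ > 0 such that for every complex-valued harmonic function h = F + conj ∘ G on Ω (F, G holomorphic on Ω) with ∬_Ω |F′|² dA + ∬_Ω |G′|² dA < ∞: C′ · ( |h(0)|² + ∬_Ω |F′|² dA + ∬_Ω |G′|² dA )^{1/2} ≤ ( ∬_Ω |h|² dA + ∬_Ω |F′|² dA + ∬_Ω |G′|² dA )^{1/2} ≤ C · ( |h(0)|² + ∬_Ω |F′|² dA + ∬_Ω |G′|² dA )^{1/2}. That is, the harmonic Dirichlet norm and the Sobolev H¹ norm are equivalent on the harmonic Dirichlet space of Ω. -/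
open MeasureTheory Real

lemma aux_sqrt (K : ℝ) (hK : 0 < K) (Y : ENNReal) :
    ENNReal.ofReal (Real.sqrt K) * Y ^ (1/2 : ℝ) = (ENNReal.ofReal K * Y) ^ (1/2 : ℝ) := by
  rw [ENNReal.mul_rpow_of_nonneg _ _ (by norm_num), ENNReal.ofReal_rpow_of_pos hK,
    Real.sqrt_eq_rpow]

lemma aux_norm (x y z w : ℂ) (h : ‖x‖ ≤ ‖y‖ + ‖z‖ + ‖w‖) :
    ENNReal.ofReal (‖x‖ ^ 2) ≤ 3 * (ENNReal.ofReal (‖y‖ ^ 2) + ENNReal.ofReal (‖z‖ ^ 2)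
      + ENNReal.ofReal (‖w‖ ^ 2)) := by
  rw [← ENNReal.ofReal_add (by positivity) (by positivity),
    ← ENNReal.ofReal_add (by positivity) (by positivity),
    show (3 : ENNReal) = ENNReal.ofReal 3 by norm_num,
    ← ENNReal.ofReal_mul (by norm_num)]
  apply ENNReal.ofReal_le_ofReal
  have := norm_nonneg x
  nlinarith [sq_nonneg (‖y‖ - ‖z‖), sq_nonneg (‖y‖ - ‖w‖), sq_nonneg (‖z‖ - ‖w‖)]

lemma aux_meas {Ω : Set ℂ} (hΩ : IsOpen Ω) {F : ℂ → ℂ} (hF : DifferentiableOn ℂ F Ω) (c : ℂ) :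
    AEMeasurable (fun z => ENNReal.ofReal (‖F z - c‖ ^ 2)) (volume.restrict Ω) := by
  have h := (hF.continuousOn.aemeasurable hΩ.measurableSet (μ := volume))
  exact (((h.sub_const c).norm).pow_const 2).ennreal_ofReal

lemma aux_real (v c a f g H : ENNReal) (k d : ℝ) (hk : 0 < k) (hd : 0 < d)
    (hv : v = ENNReal.ofReal k) (hc : c = ENNReal.ofReal d)
    (ha : a < ⊤) (hf : f < ⊤) (hg : g < ⊤)
    (h1 : H ≤ 3 * (a * v + c * f + c * g)) (h2 : a * v ≤ 3 * (H + c * f + c * g)) :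
    (ENNReal.ofReal (3 / k + 3 * d / k + 1)⁻¹ * (a + f + g) ≤ H + f + g) ∧
    (H + f + g ≤ ENNReal.ofReal (3 * k + 3 * d + 1) * (a + f + g)) := by
  subst hv hc
  lift a to NNReal using ha.ne
  lift f to NNReal using hf.ne
  lift g to NNReal using hg.ne
  have hH : H ≠ ⊤ := by
    refine ne_top_of_le_ne_top ?_ h1
    finiteness
  lift H to NNReal using hH
  lift k to NNReal using hk.le
  lift d to NNReal using hd.le
  have e1 : (3 * (k:ℝ) + 3 * d + 1) = ((3 * k + 3 * d + 1 : NNReal) : ℝ) := by push_cast; rfl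
  have e2 : (3 / (k:ℝ) + 3 * d / k + 1)⁻¹ = (((3 / k + 3 * d / k + 1)⁻¹ : NNReal) : ℝ) := by
    push_cast; rfl
  rw [e1, e2]
  simp only [ENNReal.ofReal_coe_nnreal] at *
  norm_cast at *
  simp only [← NNReal.coe_le_coe] at *
  push_cast at *
  have hk' : (0:ℝ) < k := NNReal.coe_pos.2 hk
  have hd' : (0:ℝ) < d := NNReal.coe_pos.2 hd
  have pa := a.2
  have pf := f.2
  have pg := g.2
  have pH := H.2
  simp only [NNReal.val_eq_coe] at pa pf pg pH
  generalize (a:ℝ) = a, (f:ℝ) = f, (g:ℝ) = g, (H:ℝ) = H, (k:ℝ) = k, (d:ℝ) = d at *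
  constructor
  · rw [inv_mul_le_iff₀ (by positivity)]
    have : a ≤ 3 * (H + d * f + d * g) / k := by rw [le_div_iff₀ hk']; exact h2
    have e : (3 / k + 3 * d / k + 1) * (H + f + g) = 3 * (H + d * f + d * g) / k
      + (f + g) + (H + 3 / k * (f + g) + 3 * d / k * H) := by field_simp; ring
    have : 0 ≤ H + 3 / k * (f + g) + 3 * d / k * H := by positivity
    linarith
  · have : 0 ≤ k * f := by positivity
    have : 0 ≤ k * g := by positivity
    have : 0 ≤ d * a := by positivity
    nlinarith

/-- Let `Ω ⊆ ℂ` be open and bounded with `0 ∈ Ω`, satisfying the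
analytic Poincaré inequality with constant `C₀`.  Then there exist constants
`C, C' > 0` such that for every complex-valued harmonic function `h = F + conj ∘ G`
on `Ω` (`F, G` holomorphic) of finite Dirichlet energy, the harmonic Dirichlet norm
`(|h(0)|² + ∬_Ω |F′|² + ∬_Ω |G′|²)^{1/2}` and the Sobolev `H¹` norm
`(∬_Ω |h|² + ∬_Ω |F′|² + ∬_Ω |G′|²)^{1/2}` are comparable:
`C′ ⬝ Dirichlet ≤ Sobolev ≤ C ⬝ Dirichlet`. -/
theorem dirichlet_sobolev_norm_equivalence
    (Ω : Set ℂ) (hΩopen : IsOpen Ω) (hΩbdd : Bornology.IsBounded Ω) (h0 : (0 : ℂ) ∈ Ω)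
    (C₀ : ℝ) (hC₀ : 0 < C₀)
    (hPoincare : ∀ F : ℂ → ℂ, DifferentiableOn ℂ F Ω →
      (∫⁻ z in Ω, ENNReal.ofReal (‖deriv F z‖ ^ 2) ∂volume) < ⊤ →
      (∫⁻ z in Ω, ENNReal.ofReal (‖F z - F 0‖ ^ 2) ∂volume)
        ≤ ENNReal.ofReal (C₀ ^ 2)
            * ∫⁻ z in Ω, ENNReal.ofReal (‖deriv F z‖ ^ 2) ∂volume) :
    ∃ C > (0 : ℝ), ∃ C' > (0 : ℝ),
      ∀ F G h : ℂ → ℂ, DifferentiableOn ℂ F Ω → DifferentiableOn ℂ G Ω →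
        (∀ z ∈ Ω, h z = F z + starRingEnd ℂ (G z)) →
        (∫⁻ z in Ω, ENNReal.ofReal (‖deriv F z‖ ^ 2) ∂volume)
          + (∫⁻ z in Ω, ENNReal.ofReal (‖deriv G z‖ ^ 2) ∂volume) < ⊤ →
        (ENNReal.ofReal C'
            * (ENNReal.ofReal (‖h 0‖ ^ 2)
                + (∫⁻ z in Ω, ENNReal.ofReal (‖deriv F z‖ ^ 2) ∂volume)
                + (∫⁻ z in Ω, ENNReal.ofReal (‖deriv G z‖ ^ 2) ∂volume)) ^ (1/2 : ℝ)
          ≤ ((∫⁻ z in Ω, ENNReal.ofReal (‖h z‖ ^ 2) ∂volume)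
                + (∫⁻ z in Ω, ENNReal.ofReal (‖deriv F z‖ ^ 2) ∂volume)
                + (∫⁻ z in Ω, ENNReal.ofReal (‖deriv G z‖ ^ 2) ∂volume)) ^ (1/2 : ℝ))
        ∧ ((∫⁻ z in Ω, ENNReal.ofReal (‖h z‖ ^ 2) ∂volume)
                + (∫⁻ z in Ω, ENNReal.ofReal (‖deriv F z‖ ^ 2) ∂volume)
                + (∫⁻ z in Ω, ENNReal.ofReal (‖deriv G z‖ ^ 2) ∂volume)) ^ (1/2 : ℝ)
          ≤ ENNReal.ofReal C
            * (ENNReal.ofReal (‖h 0‖ ^ 2)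
                + (∫⁻ z in Ω, ENNReal.ofReal (‖deriv F z‖ ^ 2) ∂volume)
                + (∫⁻ z in Ω, ENNReal.ofReal (‖deriv G z‖ ^ 2) ∂volume)) ^ (1/2 : ℝ) := by
  have hVpos : 0 < volume Ω := hΩopen.measure_pos volume ⟨0, h0⟩
  have hVfin : volume Ω < ⊤ := hΩbdd.measure_lt_top
  set k := (volume Ω).toReal with hkdef
  have hk : 0 < k := ENNReal.toReal_pos hVpos.ne' hVfin.ne
  have hkv : volume Ω = ENNReal.ofReal k := (ENNReal.ofReal_toReal hVfin.ne).symm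
  have hd : 0 < C₀ ^ 2 := by positivity
  refine ⟨Real.sqrt (3 * k + 3 * C₀ ^ 2 + 1), by positivity,
    Real.sqrt (3 / k + 3 * C₀ ^ 2 / k + 1)⁻¹, by positivity, ?_⟩
  intro F G h hF hG hh hfin
  obtain ⟨hf, hg⟩ := ENNReal.add_lt_top.1 hfin
  have PF := hPoincare F hF hf
  have PG := hPoincare G hG hg
  have mF := aux_meas hΩopen hF (F 0)
  have mG := aux_meas hΩopen hG (G 0)
  have key : ∀ z ∈ Ω, h z - h 0 = (F z - F 0) + starRingEnd ℂ (G z - G 0) := by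
    intro z hz
    rw [hh z hz, hh 0 h0, map_sub]; ring
  have nG : ∀ z, ‖starRingEnd ℂ (G z - G 0)‖ = ‖G z - G 0‖ := fun z => RCLike.norm_conj _
  have hm := hΩopen.measurableSet
  have h1 : (∫⁻ z in Ω, ENNReal.ofReal (‖h z‖ ^ 2) ∂volume) ≤
      3 * (ENNReal.ofReal (‖h 0‖ ^ 2) * volume Ω
        + (∫⁻ z in Ω, ENNReal.ofReal (‖F z - F 0‖ ^ 2) ∂volume)
        + (∫⁻ z in Ω, ENNReal.ofReal (‖G z - G 0‖ ^ 2) ∂volume)) := by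
    rw [← setLIntegral_const, ← lintegral_add_right' _ mF, ← lintegral_add_right' _ mG,
      ← lintegral_const_mul' _ _ (by norm_num)]
    refine setLIntegral_mono' hm fun z hz => aux_norm _ _ _ _ ?_
    have e : h z = h 0 + (F z - F 0) + starRingEnd ℂ (G z - G 0) := by
      linear_combination key z hz
    rw [e, ← nG]
    exact norm_add₃_le
  have h2 : ENNReal.ofReal (‖h 0‖ ^ 2) * volume Ω ≤
      3 * ((∫⁻ z in Ω, ENNReal.ofReal (‖h z‖ ^ 2) ∂volume)
        + (∫⁻ z in Ω, ENNReal.ofReal (‖F z - F 0‖ ^ 2) ∂volume)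
        + (∫⁻ z in Ω, ENNReal.ofReal (‖G z - G 0‖ ^ 2) ∂volume)) := by
    rw [← setLIntegral_const, ← lintegral_add_right' _ mF, ← lintegral_add_right' _ mG,
      ← lintegral_const_mul' _ _ (by norm_num)]
    refine setLIntegral_mono' hm fun z hz => aux_norm _ _ _ _ ?_
    have e : h 0 = h z + -(F z - F 0) + -starRingEnd ℂ (G z - G 0) := by
      linear_combination -key z hz
    rw [e, ← nG, ← norm_neg (F z - F 0), ← norm_neg (starRingEnd ℂ (G z - G 0))]
    exact norm_add₃_le
  have R := aux_real (volume Ω) (ENNReal.ofReal (C₀ ^ 2)) (ENNReal.ofReal (‖h 0‖ ^ 2)) _ _ _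
    k (C₀ ^ 2) hk hd hkv rfl ENNReal.ofReal_lt_top hf hg
    (h1.trans (by gcongr)) (h2.trans (by gcongr))
  rw [aux_sqrt _ (by positivity), aux_sqrt _ (by positivity)]
  exact ⟨ENNReal.rpow_le_rpow R.1 (by norm_num), ENNReal.rpow_le_rpow R.2 (by norm_num)⟩
end

section
/- Let u : ℝ → ℂ be 2π-periodic and square-integrable on [0, 2π], with Fourier coefficients a_n = (1/2π) ∫₀^{2π} u(t) e^{-int} dt for n ∈ ℤ. Then, as an identity in [0, ∞], ∫₀^{2π} ∫₀^{2π} |u(x) − u(y)|² / |e^{ix} − e^{iy}|² dx dy = 4π² · Σ_{n ∈ ℤ} |n| |a_n|². In particular, the left-hand double integral is finite if and only if Σ_{n ∈ ℤ} |n| |a_n|² < ∞; that is, the Besov space B^{1/2}_{2,2}(S¹) coincides with the Sobolev space H^{1/2}(S¹) of functions with square-integrable half-order derivative, with comparable norms. -/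
open MeasureTheory Real Complex

section Helpers
open AddCircle
open scoped ENNReal

variable {T : ℝ} [hT : Fact (0 < T)]

lemma aux_parseval (f : AddCircle T → ℂ) (hf : MemLp f 2 haarAddCircle) :
    ∫⁻ x, ENNReal.ofReal (‖f x‖ ^ 2) ∂haarAddCircle
      = ∑' n : ℤ, ENNReal.ofReal (‖fourierCoeff f n‖ ^ 2) := by
  have h := hasSum_sq_fourierCoeff hf.toLp
  rw [fourierCoeff_congr_ae hf.coeFn_toLp] at h
  have h2 : ∫ t, ‖hf.toLp f t‖ ^ 2 ∂haarAddCircle = ∫ t, ‖f t‖ ^ 2 ∂haarAddCircle := by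
    apply integral_congr_ae
    filter_upwards [hf.coeFn_toLp] with x hx
    rw [hx]
  rw [h2] at h
  rw [← ENNReal.ofReal_tsum_of_nonneg (fun n => by positivity) h.summable, h.tsum_eq,
    ofReal_integral_eq_lintegral_ofReal]
  · exact hf.integrable_norm_pow (by norm_num)
  · exact Filter.Eventually.of_forall fun x => by positivity

lemma aux_zero : (haarAddCircle (T := T)) {0} = 0 := by
  have h := AddCircle.volume_closedBall T (x := (0 : AddCircle T)) 0
  rw [Metric.closedBall_zero, volume_eq_smul_haarAddCircle] at h
  have : ENNReal.ofReal T ≠ 0 := by simp [hT.out]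
  simpa [hT.out.le, this, hT.out.not_ge] using h

lemma aux_fourier_one_ne {h : AddCircle T} (hh : h ≠ 0) : (fourier 1 h : ℂ) - 1 ≠ 0 := by
  intro h1
  apply hh
  apply injective_toCircle hT.out.ne'
  ext
  rw [fourier_one] at h1
  simpa [sub_eq_zero] using h1

lemma aux_fourier_nat (n : ℕ) (h : AddCircle T) : (fourier (n : ℤ) h : ℂ) = (fourier 1 h) ^ n := by
  induction n with
  | zero => simp
  | succ n ih => rw [Nat.cast_succ, fourier_add, ih, pow_succ]

lemma aux_fejer_nat (n : ℕ) :
    ∫⁻ h, ENNReal.ofReal (‖(fourier (n : ℤ) h : ℂ) - 1‖ ^ 2 / ‖(fourier 1 h : ℂ) - 1‖ ^ 2)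
      ∂(haarAddCircle (T := T)) = ENNReal.ofReal n := by
  have h0 : ∀ᵐ h ∂(haarAddCircle (T := T)), h ≠ 0 := by
    rw [ae_iff]; simpa using aux_zero
  let g : AddCircle T → ℂ := ∑ k ∈ Finset.range n, (fun x => (fourier (k : ℤ) x : ℂ))
  have hc : ∀ k : ℤ, Continuous (fun x : AddCircle T => (fourier k x : ℂ)) :=
    fun k => (fourier k).continuous
  have hmem : ∀ k : ℤ, MemLp (fun x : AddCircle T => (fourier k x : ℂ)) 2 haarAddCircle := fun k =>
    MemLp.of_bound (hc k).aestronglyMeasurable 1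
      (Filter.Eventually.of_forall fun x => by rw [fourier_apply, Circle.norm_coe])
  have hg : MemLp g 2 haarAddCircle := memLp_finsetSum' _ fun k _ => hmem k
  have e1 : ∫⁻ h, ENNReal.ofReal
      (‖(fourier (n : ℤ) h : ℂ) - 1‖ ^ 2 / ‖(fourier 1 h : ℂ) - 1‖ ^ 2)
      ∂(haarAddCircle (T := T)) = ∫⁻ h, ENNReal.ofReal (‖g h‖ ^ 2) ∂haarAddCircle := by
    apply lintegral_congr_ae
    filter_upwards [h0] with h hh
    have hne := aux_fourier_one_ne hh
    congr 1
    rw [← div_pow, ← norm_div]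
    congr 2
    simp only [g, Finset.sum_apply, aux_fourier_nat]
    rw [geom_sum_eq (sub_ne_zero.mp hne)]
  rw [e1, aux_parseval g hg]
  have e2 : ∀ m : ℤ, fourierCoeff g m = if m ∈ (Finset.range n).image (Nat.cast : ℕ → ℤ) then 1 else 0 := by
    intro m
    have hs := fourierCoeff.sum (Finset.range n)
      (fun (k : ℕ) => (fun x : AddCircle T => (fourier (k : ℤ) x : ℂ)))
      (fun k _ => (hmem k).integrable (by norm_num))
    change fourierCoeff (∑ k ∈ Finset.range n, (fun x => (fourier (k : ℤ) x : ℂ))) m = _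
    rw [hs]
    simp only [Finset.sum_apply]
    have : ∀ k : ℤ, fourierCoeff (fun x : AddCircle T => (fourier k x : ℂ)) m = if m = k then 1 else 0 := by
      intro k
      have := congrFun (fourierCoeff_fourier (T := T) k) m
      rw [Pi.single_apply] at this
      exact this
    simp only [this]
    split_ifs with hm
    · obtain ⟨k, hk, rfl⟩ := Finset.mem_image.mp hm
      simp at hk
      simp [hk]
    · apply Finset.sum_eq_zero
      intro k hk
      rw [if_neg]
      rintro rfl
      exact hm (Finset.mem_image_of_mem _ hk)
  rw [tsum_eq_sum (s := (Finset.range n).image (Nat.cast : ℕ → ℤ))]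
  · rw [Finset.sum_congr rfl (g := fun _ => 1)]
    · simp [Finset.card_image_of_injective _ Nat.cast_injective]
    · intro m hm
      rw [e2, if_pos hm]; simp
  · intro m hm
    rw [e2, if_neg hm]; simp

lemma aux_fejer (n : ℤ) :
    ∫⁻ h, ENNReal.ofReal (‖(fourier n h : ℂ) - 1‖ ^ 2 / ‖(fourier 1 h : ℂ) - 1‖ ^ 2)
      ∂(haarAddCircle (T := T)) = ENNReal.ofReal |(n : ℝ)| := by
  obtain ⟨k, rfl | rfl⟩ := n.eq_nat_or_neg
  · rw [aux_fejer_nat]; simp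
  · rw [← abs_neg]
    simp only [Int.cast_neg, neg_neg, Int.cast_natCast, Nat.abs_cast]
    rw [← aux_fejer_nat (T := T)]
    congr 1; ext h
    rw [fourier_neg, ← Complex.norm_conj]
    simp [-fourier_apply]

lemma aux_shift (V : AddCircle T → ℂ) (hV : MemLp V 2 haarAddCircle) (h : AddCircle T) (n : ℤ) :
    fourierCoeff (fun x => V (x + h) - V x) n = ((fourier n h : ℂ) - 1) * fourierCoeff V n := by
  have hV2 : MemLp (fun x => V (x + h)) 2 haarAddCircle :=
    hV.comp_measurePreserving (measurePreserving_add_right haarAddCircle h)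
  have e : fourierCoeff (fun x => V (x + h)) n = (fourier n h : ℂ) * fourierCoeff V n := by
    unfold fourierCoeff
    rw [← integral_add_right_eq_self (μ := haarAddCircle) (fun t => fourier (-n) t • V t) h,
      ← integral_const_mul]
    congr 1; ext x
    have : (fourier (-n) (x + h) : ℂ) = fourier (-n) x * fourier (-n) h := by
      simp only [fourier_apply, zsmul_add, toCircle_add, Circle.coe_mul]
    have h1 : (fourier n h : ℂ) * fourier (-n) h = 1 := by
      rw [← fourier_add]; simp
    rw [this, smul_eq_mul, smul_eq_mul]
    linear_combination (-(fourier (-n) x : ℂ) * V (x + h)) * h1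
  rw [sub_mul, ← e, one_mul]
  unfold fourierCoeff
  rw [← integral_sub ((hV2.integrable (by norm_num)).fourier_smul _)
    ((hV.integrable (by norm_num)).fourier_smul _)]
  simp only [smul_sub]

lemma aux_main_meas (V : AddCircle T → ℂ) (hVm : Measurable V) (hV : MemLp V 2 haarAddCircle) :
    ∫⁻ x, ∫⁻ y, ENNReal.ofReal (‖V x - V y‖ ^ 2 / ‖(fourier 1 x : ℂ) - fourier 1 y‖ ^ 2)
      ∂haarAddCircle ∂haarAddCircle
    = ∑' n : ℤ, ENNReal.ofReal (|(n : ℝ)| * ‖fourierCoeff V n‖ ^ 2) := by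
  have hcm : ∀ n : ℤ, Measurable (fun x : AddCircle T => (fourier n x : ℂ)) :=
    fun n => (fourier n).continuous.measurable
  calc _ = ∫⁻ x, ∫⁻ h, ENNReal.ofReal (‖V (x + h) - V x‖ ^ 2 / ‖(fourier 1 h : ℂ) - 1‖ ^ 2)
      ∂haarAddCircle ∂haarAddCircle := by
        congr 1; ext x
        rw [← lintegral_add_left_eq_self _ x]
        congr 1; ext h
        rw [norm_sub_rev (V x), norm_sub_rev (fourier 1 x : ℂ)]
        have : (fourier 1 (x + h) : ℂ) - fourier 1 x = fourier 1 x * (fourier 1 h - 1) := by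
          simp only [fourier_one, toCircle_add, Circle.coe_mul]; ring
        rw [this, norm_mul, fourier_one, Circle.norm_coe, one_mul]
    _ = ∫⁻ h, ∫⁻ x, ENNReal.ofReal (‖V (x + h) - V x‖ ^ 2 / ‖(fourier 1 h : ℂ) - 1‖ ^ 2)
      ∂haarAddCircle ∂haarAddCircle := by
        apply lintegral_lintegral_swap
        apply Measurable.aemeasurable
        unfold Function.uncurry
        have := hcm 1
        fun_prop
    _ = ∫⁻ h, ∑' n : ℤ, ENNReal.ofReal (‖fourierCoeff V n‖ ^ 2) *
          ENNReal.ofReal (‖(fourier n h : ℂ) - 1‖ ^ 2 / ‖(fourier 1 h : ℂ) - 1‖ ^ 2)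
          ∂haarAddCircle := by
        congr 1; ext h
        have hV2 : MemLp (fun x => V (x + h)) 2 haarAddCircle :=
          hV.comp_measurePreserving (measurePreserving_add_right haarAddCircle h)
        have hp := aux_parseval _ (hV2.sub hV)
        simp only [div_eq_mul_inv]
        have : ∀ x : ℝ, 0 ≤ x → ENNReal.ofReal (x * (‖(fourier 1 h : ℂ) - 1‖ ^ 2)⁻¹)
          = ENNReal.ofReal x * ENNReal.ofReal ((‖(fourier 1 h : ℂ) - 1‖ ^ 2)⁻¹) :=
            fun x hx => ENNReal.ofReal_mul hx
        simp only [this _ (sq_nonneg _)]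
        rw [lintegral_mul_const _ (by fun_prop)]
        erw [hp]
        rw [← ENNReal.tsum_mul_right]
        congr 1; ext n
        rw [← mul_assoc]
        congr 1
        erw [aux_shift V hV h n]
        rw [norm_mul, mul_pow, mul_comm, ENNReal.ofReal_mul (by positivity)]
    _ = _ := by
        rw [lintegral_tsum]
        · congr 1; ext n
          rw [lintegral_const_mul, aux_fejer, ← ENNReal.ofReal_mul (by positivity), mul_comm]
          have := hcm n
          have := hcm 1
          fun_prop
        · intro n
          have := hcm n
          have := hcm 1
          fun_prop

lemma aux_main (U : AddCircle T → ℂ) (hU : MemLp U 2 haarAddCircle) :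
    ∫⁻ x, ∫⁻ y, ENNReal.ofReal (‖U x - U y‖ ^ 2 / ‖(fourier 1 x : ℂ) - fourier 1 y‖ ^ 2)
      ∂haarAddCircle ∂haarAddCircle
    = ∑' n : ℤ, ENNReal.ofReal (|(n : ℝ)| * ‖fourierCoeff U n‖ ^ 2) := by
  have hae := hU.1.ae_eq_mk
  rw [fourierCoeff_congr_ae hae, ← aux_main_meas _ hU.1.stronglyMeasurable_mk.measurable
    (hU.ae_eq hae)]
  apply lintegral_congr_ae
  filter_upwards [hae] with x hx
  apply lintegral_congr_ae
  filter_upwards [hae] with y hy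
  rw [← hx, ← hy]

end Helpers

/-- For a `2π`-periodic, square-integrable `u : ℝ → ℂ` with Fourier
coefficients `aₙ = (1/2π) ∫₀^{2π} u(t) e^{-int} dt`, one has the identity in `[0,∞]`
`∫₀^{2π}∫₀^{2π} |u(x) − u(y)|²/|e^{ix} − e^{iy}|² dx dy = 4π² Σ_{n ∈ ℤ} |n| |aₙ|²`.
In particular the Besov space `B^{1/2}_{2,2}(S¹)` coincides with the Sobolev space
`H^{1/2}(S¹)`. -/
theorem besov_half_equals_sobolev_half
    (u : ℝ → ℂ) (hper : Function.Periodic u (2 * π))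
    (hL2 : MemLp u 2 (volume.restrict (Set.Ioc (0 : ℝ) (2 * π))))
    (a : ℤ → ℂ)
    (ha : ∀ n : ℤ, a n = (1 / (2 * (π : ℂ))) *
      ∫ t in (0 : ℝ)..(2 * π), u t * Complex.exp (-(n : ℂ) * t * Complex.I)) :
    ∫⁻ x in Set.Ioc (0 : ℝ) (2 * π), ∫⁻ y in Set.Ioc (0 : ℝ) (2 * π),
        ENNReal.ofReal
          (‖u x - u y‖ ^ 2 / ‖Complex.exp (x * Complex.I) - Complex.exp (y * Complex.I)‖ ^ 2)
        ∂volume ∂volume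
      = ENNReal.ofReal (4 * π ^ 2)
          * ∑' n : ℤ, ENNReal.ofReal (|(n : ℝ)| * ‖a n‖ ^ 2) := by
  have hpi := Real.two_pi_pos
  have : Fact (0 < 2 * π) := ⟨hpi⟩
  have hπ : (π : ℂ) ≠ 0 := by exact_mod_cast Real.pi_ne_zero
  let U := AddCircle.liftIoc (2 * π) 0 u
  have hz : (0 : ℝ) + 2 * π = 2 * π := zero_add _
  have hUu : ∀ x ∈ Set.Ioc (0 : ℝ) (2 * π), U (x : AddCircle (2 * π)) = u x := fun x hx =>
    AddCircle.liftIoc_coe_apply (by rwa [hz])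
  have hU : MemLp U 2 AddCircle.haarAddCircle := by
    rw [← hz] at hL2
    have h := MemLp.memLp_liftIoc hL2
    exact h.haarAddCircle
  have hf : ∀ (n : ℤ) (x : ℝ), (fourier n (x : AddCircle (2 * π)) : ℂ) = exp (n * x * I) := by
    intro n x
    rw [fourier_coe_apply]
    congr 1
    push_cast
    field_simp
  have hcoef : ∀ n, fourierCoeff U n = a n := by
    intro n
    rw [fourierCoeff_eq_intervalIntegral U n 0, ha, hz, Complex.real_smul]
    push_cast
    congr 1
    rw [intervalIntegral.integral_of_le hpi.le, intervalIntegral.integral_of_le hpi.le]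
    apply setIntegral_congr_fun measurableSet_Ioc
    intro x hx
    simp only [smul_eq_mul]
    rw [hUu x hx, hf, mul_comm]
    push_cast
    rfl
  have hmain := aux_main U hU
  simp only [hcoef] at hmain
  rw [← hmain]
  have hlin : ∀ f : AddCircle (2 * π) → ENNReal, ∫⁻ x in Set.Ioc (0 : ℝ) (2 * π), f x
      = ENNReal.ofReal (2 * π) * ∫⁻ x, f x ∂AddCircle.haarAddCircle := by
    intro f
    have := AddCircle.lintegral_preimage (2 * π) 0 f
    rw [hz] at this
    rw [this, AddCircle.volume_eq_smul_haarAddCircle, lintegral_smul_measure, smul_eq_mul]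
  calc _ = ∫⁻ x in Set.Ioc (0 : ℝ) (2 * π), (fun x : AddCircle (2 * π) =>
        ENNReal.ofReal (2 * π) * ∫⁻ y, ENNReal.ofReal
          (‖U x - U y‖ ^ 2 / ‖(fourier 1 x : ℂ) - fourier 1 y‖ ^ 2) ∂AddCircle.haarAddCircle) x := by
        apply setLIntegral_congr_fun measurableSet_Ioc
        intro x hx
        simp only []
        rw [← hlin]
        apply setLIntegral_congr_fun measurableSet_Ioc
        intro y hy
        simp only []
        rw [hUu x hx, hUu y hy, hf, hf]
        simp
    _ = _ := by
        refine (hlin (fun x : AddCircle (2 * π) =>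
          ENNReal.ofReal (2 * π) * ∫⁻ y, ENNReal.ofReal
          (‖U x - U y‖ ^ 2 / ‖(fourier 1 x : ℂ) - fourier 1 y‖ ^ 2)
            ∂AddCircle.haarAddCircle)).trans ?_
        rw [lintegral_const_mul' _ _ ENNReal.ofReal_ne_top, ← mul_assoc,
          ← ENNReal.ofReal_mul hpi.le]
        congr 2
        ring
end

section
/- Let Ω ⊆ ℂ be an open connected set and z₀ ∈ Ω. Let h and h₁, h₂, h₃, … be holomorphic functions on Ω such that h_n(z₀) → h(z₀) and ∬_Ω |h_n′ − h′|² dA → 0 as n → ∞. Then h_n → h uniformly on every compact subset of Ω. In other words, convergence in the Dirichlet-space norm (|g(z₀)|² + ∬_Ω |g′|² dA)^{1/2} implies uniform convergence on compact subsets of Ω. -/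
open MeasureTheory Filter Topology

lemma dcl_angular (G : ℂ → ℂ) (c : ℂ) (r ρ : ℝ) (hρ : 0 < ρ) (hρr : ρ < r)
    (hG : DifferentiableOn ℂ G (Metric.ball c r)) :
    ENNReal.ofReal (2 * Real.pi) * ‖G c‖ₑ ≤
      ∫⁻ θ in Set.Ioo (-Real.pi) Real.pi, ‖G (c + Complex.polarCoord.symm (ρ, θ))‖ₑ := by
  have hd : DiffContOnCl ℂ G (Metric.ball c |ρ|) := by
    apply DifferentiableOn.diffContOnCl
    rw [abs_of_pos hρ]
    apply hG.mono
    exact Metric.closure_ball_subset_closedBall.trans (Metric.closedBall_subset_ball hρr)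
  have h1 := hd.circleAverage
  rw [Real.circleAverage_eq_integral_add (-Real.pi),
    intervalIntegral.integral_comp_add_right (fun θ ↦ G (circleMap c ρ θ))] at h1
  have e1 : (0 : ℝ) + -Real.pi = -Real.pi := by ring
  have e2 : 2 * Real.pi + -Real.pi = Real.pi := by ring
  have hpi := Real.pi_pos
  rw [e1, e2, intervalIntegral.integral_of_le (by linarith), integral_Ioc_eq_integral_Ioo] at h1
  have h2 : (2 * Real.pi) • G c =
      ∫ θ in Set.Ioo (-Real.pi) Real.pi, G (circleMap c ρ θ) := by
    rw [← h1, smul_smul, mul_inv_cancel₀ (by positivity), one_smul]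
  calc ENNReal.ofReal (2 * Real.pi) * ‖G c‖ₑ = ‖(2 * Real.pi) • G c‖ₑ := by
        rw [enorm_smul, Real.enorm_of_nonneg (by positivity)]
    _ ≤ ∫⁻ θ in Set.Ioo (-Real.pi) Real.pi, ‖G (circleMap c ρ θ)‖ₑ := by
        rw [h2]; exact enorm_integral_le_lintegral_enorm _
    _ = _ := by
        congr 1
        ext θ
        simp [circleMap, Complex.exp_mul_I]

lemma dcl_area (G : ℂ → ℂ) (c : ℂ) (r : ℝ) (hr : 0 < r) (hm : Measurable G)
    (hG : DifferentiableOn ℂ G (Metric.ball c r)) :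
    ENNReal.ofReal (r ^ 2) * ‖G c‖ₑ ≤ ∫⁻ z in Metric.ball c r, ‖G z‖ₑ := by
  have hpi := Real.pi_pos
  rw [← lintegral_indicator Metric.isOpen_ball.measurableSet,
    ← lintegral_add_left_eq_self _ c, ← Complex.lintegral_comp_polarCoord_symm]
  have hsub : Set.Ioo (r / 2) r ×ˢ Set.Ioo (-Real.pi) Real.pi ⊆ polarCoord.target := by
    rintro ⟨ρ, θ⟩ ⟨h1, h2⟩
    exact ⟨lt_trans (by positivity) h1.1, h2⟩
  have hmeas : Measurable fun p : ℝ × ℝ => Complex.polarCoord.symm p := by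
    have : Continuous fun p : ℝ × ℝ => Complex.polarCoord.symm p := by
      simp only [Complex.polarCoord_symm_apply]
      fun_prop
    exact this.measurable
  calc ENNReal.ofReal (r ^ 2) * ‖G c‖ₑ
      ≤ ∫⁻ ρ in Set.Ioo (r / 2) r,
          ENNReal.ofReal (r / 2) * (ENNReal.ofReal (2 * Real.pi) * ‖G c‖ₑ) := by
        rw [setLIntegral_const, Real.volume_Ioo, ← mul_assoc, mul_right_comm,
          ← ENNReal.ofReal_mul (by positivity), ← ENNReal.ofReal_mul (by positivity)]
        gcongr
        nlinarith [Real.pi_gt_three, sq_nonneg r]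
    _ ≤ ∫⁻ ρ in Set.Ioo (r / 2) r, ∫⁻ θ in Set.Ioo (-Real.pi) Real.pi,
          ENNReal.ofReal ρ * ‖G (c + Complex.polarCoord.symm (ρ, θ))‖ₑ := by
        apply setLIntegral_mono' measurableSet_Ioo
        intro ρ hρ
        rw [lintegral_const_mul' _ _ ENNReal.ofReal_ne_top]
        gcongr
        · exact hρ.1.le
        · exact dcl_angular G c r ρ (lt_trans (by positivity) hρ.1) hρ.2 hG
    _ = ∫⁻ p in Set.Ioo (r / 2) r ×ˢ Set.Ioo (-Real.pi) Real.pi,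
          ENNReal.ofReal p.1 * ‖G (c + Complex.polarCoord.symm p)‖ₑ := by
        rw [Measure.volume_eq_prod, setLIntegral_prod]
        apply Measurable.aemeasurable
        exact (ENNReal.measurable_ofReal.comp measurable_fst).mul
          (hm.comp (hmeas.const_add c)).enorm
    _ = ∫⁻ p in Set.Ioo (r / 2) r ×ˢ Set.Ioo (-Real.pi) Real.pi,
          ENNReal.ofReal p.1 • (Metric.ball c r).indicator (fun z => ‖G z‖ₑ)
            (c + Complex.polarCoord.symm p) := by
        apply setLIntegral_congr_fun (measurableSet_Ioo.prod measurableSet_Ioo)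
        rintro ⟨ρ, θ⟩ ⟨h1, h2⟩
        have h1' : r / 2 < ρ ∧ ρ < r := h1
        have : c + Complex.polarCoord.symm (ρ, θ) ∈ Metric.ball c r := by
          rw [Metric.mem_ball, dist_eq_norm, add_sub_cancel_left, Complex.norm_polarCoord_symm,
            abs_of_pos (lt_trans (by positivity) h1'.1)]
          exact h1'.2
        simp only [smul_eq_mul, Set.indicator_of_mem this]
    _ ≤ _ := lintegral_mono_set hsub

/-- Let `Ω ⊆ ℂ` be open and connected, `z₀ ∈ Ω`, and let `h` and
`h₁, h₂, …` be holomorphic on `Ω` with `hₙ(z₀) → h(z₀)` and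
`∬_Ω |hₙ′ − h′|² dA → 0`.  Then `hₙ → h` uniformly on every compact subset of `Ω`;
i.e. convergence in the Dirichlet-space norm implies uniform convergence on
compact subsets. -/
theorem dirichlet_convergence_implies_locally_uniform
    (Ω : Set ℂ) (hΩopen : IsOpen Ω) (hΩconn : IsConnected Ω) (z₀ : ℂ) (hz₀ : z₀ ∈ Ω)
    (h : ℂ → ℂ) (hs : ℕ → ℂ → ℂ)
    (hhol : DifferentiableOn ℂ h Ω) (hshol : ∀ n, DifferentiableOn ℂ (hs n) Ω)
    (hval : Tendsto (fun n => hs n z₀) atTop (nhds (h z₀)))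
    (henergy : Tendsto
      (fun n => ∫⁻ z in Ω, ENNReal.ofReal (‖deriv (hs n) z - deriv h z‖ ^ 2) ∂volume)
      atTop (nhds 0)) :
    ∀ K : Set ℂ, K ⊆ Ω → IsCompact K →
      TendstoUniformlyOn (fun n => hs n) h atTop K := by
  have key : ∀ x ∈ Ω, ∃ r > 0, Metric.ball x r ⊆ Ω ∧ ∀ ε > 0, ∀ᶠ n in atTop,
      ∀ y ∈ Metric.ball x r, ‖(hs n y - h y) - (hs n x - h x)‖ < ε := by
    intro x hx
    obtain ⟨R, hR, hRΩ⟩ := Metric.isOpen_iff.1 hΩopen x hx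
    set r := R / 2 with hr
    have hr0 : 0 < r := by positivity
    have hsubΩ : Metric.ball x r ⊆ Ω :=
      (Metric.ball_subset_ball (by linarith)).trans hRΩ
    refine ⟨r, hr0, hsubΩ, fun ε hε => ?_⟩
    set δ := ε / (2 * r) with hδ
    have hδ0 : 0 < δ := by positivity
    have hpos : (0 : ENNReal) < ENNReal.ofReal (r ^ 2 * δ ^ 2) :=
      ENNReal.ofReal_pos.2 (by positivity)
    filter_upwards [henergy.eventually (gt_mem_nhds hpos)] with n hn y hy
    have hbound : ∀ z ∈ Metric.ball x r, ‖deriv (hs n) z - deriv h z‖ ≤ δ := by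
      intro z hz
      have hzΩ : Metric.ball z r ⊆ Ω := by
        refine subset_trans (fun w hw => ?_) hRΩ
        rw [Metric.mem_ball] at *
        linarith [dist_triangle w z x]
      have h1 := dcl_area (fun w => (deriv (hs n) w - deriv h w) ^ 2) z r hr0
        (((measurable_deriv _).sub (measurable_deriv _)).pow_const 2)
        (((((hshol n).deriv hΩopen).sub (hhol.deriv hΩopen)).pow 2).mono hzΩ)
      have h2 : ENNReal.ofReal (r ^ 2 * ‖deriv (hs n) z - deriv h z‖ ^ 2) <
          ENNReal.ofReal (r ^ 2 * δ ^ 2) := by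
        refine lt_of_le_of_lt ?_ hn
        refine le_trans ?_ (lintegral_mono_set hzΩ)
        rw [ENNReal.ofReal_mul (by positivity)]
        simpa only [← ofReal_norm, norm_pow] using h1
      have h3 := (ENNReal.ofReal_lt_ofReal_iff (by positivity)).1 h2
      have h4 := lt_of_mul_lt_mul_left h3 (by positivity)
      exact (lt_of_pow_lt_pow_left₀ 2 hδ0.le h4).le
    have hmv := Convex.norm_image_sub_le_of_norm_hasDerivWithin_le
      (f := fun w => hs n w - h w) (f' := fun w => deriv (hs n) w - deriv h w)
      (s := Metric.ball x r) (C := δ)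
      (fun w hw => ((((hshol n).differentiableAt (hΩopen.mem_nhds (hsubΩ hw))).hasDerivAt).sub
        ((hhol.differentiableAt (hΩopen.mem_nhds (hsubΩ hw))).hasDerivAt)).hasDerivWithinAt)
      hbound (convex_ball x r) (Metric.mem_ball_self hr0) hy
    have hy' : ‖y - x‖ < r := by simpa [dist_eq_norm] using hy
    have : δ * r = ε / 2 := by rw [hδ]; field_simp
    calc _ ≤ δ * ‖y - x‖ := hmv
      _ ≤ δ * r := by gcongr
      _ < ε := by rw [this]; linarith
  have loc : ∀ x ∈ Ω, ∃ r > 0, Metric.ball x r ⊆ Ω ∧ ∀ w ∈ Metric.ball x r,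
      Tendsto (fun n => (hs n w - h w) - (hs n x - h x)) atTop (𝓝 0) := by
    intro x hx
    obtain ⟨r, hr, hrΩ, hk⟩ := key x hx
    refine ⟨r, hr, hrΩ, fun w hw => ?_⟩
    rw [Metric.tendsto_nhds]
    intro ε hε
    filter_upwards [hk ε hε] with n hn
    simpa using hn w hw
  have ptw : ∀ x ∈ Ω, Tendsto (fun n => hs n x - h x) atTop (𝓝 0) := by
    intro x hx
    have := hΩconn.isPreconnected.induction₂
      (fun a b => Tendsto (fun n => (hs n b - h b) - (hs n a - h a)) atTop (𝓝 0))
      (fun a ha => by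
        obtain ⟨r, hr, -, hk⟩ := loc a ha
        exact mem_nhdsWithin_of_mem_nhds (mem_of_superset (Metric.ball_mem_nhds a hr) hk))
      (fun a b c _ _ _ h1 h2 => by
        have := h1.add h2
        rw [add_zero] at this
        refine this.congr fun n => by ring)
      (fun a b _ _ h1 => by
        have := h1.neg
        rw [neg_zero] at this
        refine this.congr fun n => by ring) hz₀ hx
    have h0 : Tendsto (fun n => hs n z₀ - h z₀) atTop (𝓝 0) := by
      simpa using hval.sub_const (h z₀)
    have h1 := this.add h0
    rw [add_zero] at h1
    exact h1.congr fun n => by ring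
  rw [← tendstoLocallyUniformlyOn_iff_forall_isCompact hΩopen,
    Metric.tendstoLocallyUniformlyOn_iff]
  intro ε hε x hx
  obtain ⟨r, hr, hrΩ, hk⟩ := key x hx
  refine ⟨Metric.ball x r, mem_nhdsWithin_of_mem_nhds (Metric.ball_mem_nhds x hr), ?_⟩
  filter_upwards [hk (ε / 2) (by positivity),
    (Metric.tendsto_nhds.1 (ptw x hx)) (ε / 2) (by positivity)] with n h1 h2 y hy
  have h3 := h1 y hy
  rw [dist_zero_right] at h2
  rw [dist_comm, dist_eq_norm]
  calc ‖hs n y - h y‖ = ‖((hs n y - h y) - (hs n x - h x)) + (hs n x - h x)‖ := by congr 1; ring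
    _ ≤ _ := norm_add_le _ _
    _ < ε := by linarith
end
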